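/- Let 𝒞 be the tropical complex of the tropical matroid polytope P with d+1 elements and rank k. A tuple (t_1,…,t_{d+1}) ∈ ℕ^{d+1} is the coarse type of an inclusion-maximal cell of 𝒞 if and only if there exist d' ∈ {0,1,…,d−k+1} and distinct indices i_1,…,i_{d'+1} ∈ [d+1] such that [d+1]∖{i_1,…,i_{d'}} contains a basis of 𝓜 and t_{i_1} = b_{{i_1},∅} + b_{∅,{i_1,…,i_{d'+1}}}, t_{i_l} = b_{{i_l},{i_1,…,i_{l−1}}} for l = 2,…,d'+1, and t_j = 0 for all other j. -/

import Mathlib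

open Finset

noncomputable section

variable {d n : ℕ}

/-- `x ∈ tconv {v i}`, at the level of representatives in `ℝ^{d+1}` modulo constants. -/
def InTconv {ι : Type*} (v : ι → Fin (d + 1) → ℝ) (x : Fin (d + 1) → ℝ) : Prop :=
  ∃ (lam : ι → ℝ) (c : ℝ), ∀ j, x j + c = ⨅ i, (lam i + v i j)

/-- the `k`-th entry of the type of `x` with respect to the generators `v` -/
def typeEntry {ι : Type*} (v : ι → Fin (d + 1) → ℝ) (x : Fin (d + 1) → ℝ)
    (k : Fin (d + 1)) : Set ι :=
  {i | v i k - x k = ⨅ j, (v i j - x j)}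

/-- the spanning subgraph of `G` whose edges are those indexed by `B` -/
def edgeGraph {W : Type*} (G : SimpleGraph W) (ε : Fin (d + 1) ≃ G.edgeSet)
    (B : Finset (Fin (d + 1))) : SimpleGraph W :=
  SimpleGraph.fromEdgeSet {s | ∃ i ∈ B, (ε i : Sym2 W) = s}

/-- `B ⊆ [d+1]` is the edge set of a spanning tree of `G` -/
def IsSpanningTreeEdges {W : Type*} (G : SimpleGraph W) (ε : Fin (d + 1) ≃ G.edgeSet)
    (B : Finset (Fin (d + 1))) : Prop :=
  (edgeGraph G ε B).IsTree

/-- generators of the tropical matroid polytope, in canonical coordinates -/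
def gen (Bs : Fin n → Finset (Fin (d + 1))) (l : Fin n) (i : Fin (d + 1)) : ℝ :=
  if i ∈ Bs l then 0 else 1

/-- data of the cycle matroid of a connected bridgeless simple graph `G` whose `d+1` edges are
enumerated by `ε` and whose bases (spanning-tree edge sets, each of rank/cardinality `k`) are
enumerated without repetition by `Bs`. -/
structure MatroidData (d n k : ℕ) (W : Type) (G : SimpleGraph W)
    (ε : Fin (d + 1) ≃ G.edgeSet) (Bs : Fin n → Finset (Fin (d + 1))) : Prop where
  connected : G.Connected
  bridgeless : ∀ i : Fin (d + 1), ¬ G.IsBridge (ε i : Sym2 W)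
  tree : ∀ l, IsSpanningTreeEdges G ε (Bs l)
  inj : Function.Injective Bs
  all : ∀ B : Finset (Fin (d + 1)), IsSpanningTreeEdges G ε B → ∃ l, Bs l = B
  card : ∀ l, (Bs l).card = k

/-- minimum of `f` over a subset of coordinates (as an infimum) -/
def tmin (I : Set (Fin (d + 1))) (f : Fin (d + 1) → ℝ) : ℝ := sInf (f '' I)

/-- the closed tropical halfspace with apex `p` and type `I` -/
def Halfspace (p : Fin (d + 1) → ℝ) (I : Set (Fin (d + 1))) : Set (Fin (d + 1) → ℝ) :=
  {x | tmin I (fun i => x i - p i) ≤ tmin Iᶜ (fun j => x j - p j)}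

/-- the closed cell of the tropical complex containing `p` -/
def closedCell {ι : Type*} (v : ι → Fin (d + 1) → ℝ) (p : Fin (d + 1) → ℝ) :
    Set (Fin (d + 1) → ℝ) :=
  {x | ∀ k, typeEntry v p k ⊆ typeEntry v x k}

/-- the (closed) cells of the tropical complex `𝒞_V` -/
def IsCell {ι : Type*} (v : ι → Fin (d + 1) → ℝ) (X : Set (Fin (d + 1) → ℝ)) : Prop :=
  ∃ p, X = closedCell v p

/-- the chart `c₀ : 𝕋^d → ℝ^d` -/
def chart (x : Fin (d + 1) → ℝ) (i : Fin d) : ℝ := x i.succ - x 0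

/-- a bounded cell of the tropical complex (bounded as a subset of `𝕋^d ≅ ℝ^d`) -/
def IsBoundedCell {ι : Type*} (v : ι → Fin (d + 1) → ℝ) (X : Set (Fin (d + 1) → ℝ)) : Prop :=
  IsCell v X ∧ Bornology.IsBounded (chart '' X)

/-- an inclusion-maximal bounded cell -/
def IsMaxBoundedCell {ι : Type*} (v : ι → Fin (d + 1) → ℝ) (X : Set (Fin (d + 1) → ℝ)) : Prop :=
  IsBoundedCell v X ∧ ∀ Y, IsBoundedCell v Y → X ⊆ Y → Y = X

/-- an inclusion-maximal cell -/
def IsMaxCell {ι : Type*} (v : ι → Fin (d + 1) → ℝ) (X : Set (Fin (d + 1) → ℝ)) : Prop :=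
  IsCell v X ∧ ∀ Y, IsCell v Y → X ⊆ Y → Y = X

/-- a point of the relative interior of a cell `X`: a point of `X` whose type is
componentwise contained in the type of every point of `X` -/
def IsInteriorPoint {ι : Type*} (v : ι → Fin (d + 1) → ℝ) (X : Set (Fin (d + 1) → ℝ))
    (x : Fin (d + 1) → ℝ) : Prop :=
  x ∈ X ∧ ∀ y ∈ X, ∀ k, typeEntry v x k ⊆ typeEntry v y k

/-- `b_{I,J}`: the number of bases `B` with `I ⊆ B` and `J ∩ B = ∅` -/
def bIJ (Bs : Fin n → Finset (Fin (d + 1))) (I J : Finset (Fin (d + 1))) : ℕ :=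
  (Finset.univ.filter fun l => I ⊆ Bs l ∧ Disjoint J (Bs l)).card

/-- a pseudovertex of the tropical complex: the unique point of `𝕋^d` of its type -/
def IsPseudovertex {ι : Type*} (v : ι → Fin (d + 1) → ℝ) (x : Fin (d + 1) → ℝ) : Prop :=
  ∀ y, (∀ k, typeEntry v y k = typeEntry v x k) → ∃ c : ℝ, y = fun j => x j + c

/-- the pseudovertex `e_{i₁,…,i_s} = -e_J`, `J = [d+1] ∖ {σ 0,…,σ (s-1)}`, in canonical
coordinates: coordinate `1` at `σ 0, …, σ (s-1)` and `0` elsewhere -/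
def ptSeq {r : ℕ} (σ : Fin r → Fin (d + 1)) (s : ℕ) (j : Fin (d + 1)) : ℝ :=
  if ∃ t : Fin r, (t : ℕ) < s ∧ σ t = j then 1 else 0

/-- the generators `-e_I`, `|I| = k`, of the tropical hypersimplex `Δ_k^d`, in
canonical coordinates -/
def genU (d k : ℕ) : {I : Finset (Fin (d + 1)) // I.card = k} → Fin (d + 1) → ℝ :=
  fun I j => if j ∈ I.1 then 0 else 1

theorem mem_typeEntry_iff {ι : Type*} (v : ι → Fin (d + 1) → ℝ) (x : Fin (d + 1) → ℝ)
    (k : Fin (d + 1)) (l : ι) :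
    l ∈ typeEntry v x k ↔ ∀ j, v l k - x k ≤ v l j - x j := by
  have hbdd : BddBelow (Set.range fun j => v l j - x j) := (Set.finite_range _).bddBelow
  constructor
  · intro h j
    rw [show v l k - x k = _ from h]
    exact ciInf_le hbdd j
  · intro h
    exact le_antisymm (le_ciInf h) (ciInf_le hbdd k)

theorem exists_mem_typeEntry {ι : Type*} (v : ι → Fin (d + 1) → ℝ) (x : Fin (d + 1) → ℝ)
    (l : ι) : ∃ k, l ∈ typeEntry v x k := by
  obtain ⟨k, hk⟩ := Finite.exists_min fun j => v l j - x j
  exact ⟨k, (mem_typeEntry_iff v x k l).2 hk⟩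

/-- A cell is inclusion-maximal if every generator occurs only once in the type of its
defining point. -/
theorem isMaxCell_closedCell {ι : Type*} {v : ι → Fin (d + 1) → ℝ} {x : Fin (d + 1) → ℝ}
    (h : ∀ l i j, l ∈ typeEntry v x i → l ∈ typeEntry v x j → i = j) :
    IsMaxCell v (closedCell v x) := by
  refine ⟨⟨x, rfl⟩, ?_⟩
  rintro _ ⟨q, rfl⟩ hsub
  have hx : x ∈ closedCell v q := hsub fun _ => subset_rfl
  have hq : typeEntry v x = typeEntry v q := by
    funext i
    refine Set.Subset.antisymm (fun l hl => ?_) (hx i)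
    obtain ⟨j, hj⟩ := exists_mem_typeEntry v q l
    rwa [h l i j hl (hx j hj)]
  simp only [closedCell, hq]

/-- Arbitrarily close to `p` there are points with pairwise distinct coordinates, none of
whose coordinate differences is `1`, whose type is contained in that of `p`. -/
theorem exists_generic_typeEntry_subset {ι : Type*} [Finite ι] (v : ι → Fin (d + 1) → ℝ)
    (p : Fin (d + 1) → ℝ) :
    ∃ y : Fin (d + 1) → ℝ, Function.Injective y ∧ (∀ i j, y i ≠ y j - 1) ∧
      ∀ k, typeEntry v y k ⊆ typeEntry v p k := by
  have hgen : ∀ i j : Fin (d + 1), i ≠ j → ∀ c : ℝ, ∀ᶠ δ : ℝ in nhdsWithin 0 {0}ᶜ,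
      p i + δ * i ≠ p j + δ * j + c := by
    intro i j hij c
    have hfin : {δ : ℝ | p i + δ * i = p j + δ * j + c}.Finite := by
      refine Set.Subsingleton.finite fun a ha b hb => ?_
      have hne : ((i : ℕ) : ℝ) - (j : ℕ) ≠ 0 := by
        rw [sub_ne_zero]
        exact_mod_cast fun h => hij (Fin.ext h)
      simp only [Set.mem_ofPred_eq] at ha hb
      exact mul_right_cancel₀ hne (by linarith)
    exact (nhdsNE_le_cofinite 0) hfin.eventually_cofinite_notMem
  have hlt : ∀ l i j, v l i - p i < v l j - p j → ∀ᶠ δ : ℝ in nhdsWithin 0 {0}ᶜ,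
      v l i - (p i + δ * i) < v l j - (p j + δ * j) := by
    intro l i j h
    refine nhdsWithin_le_nhds ?_
    refine ContinuousAt.eventually_lt (by fun_prop) (by fun_prop) ?_
    simpa using h
  have hev : ∀ᶠ δ : ℝ in nhdsWithin 0 {0}ᶜ,
      (∀ i j : Fin (d + 1), i ≠ j → p i + δ * i ≠ p j + δ * j + 0) ∧
      (∀ i j : Fin (d + 1), i ≠ j → p i + δ * i ≠ p j + δ * j + -1) ∧
      ∀ l i j, v l i - p i < v l j - p j → v l i - (p i + δ * i) < v l j - (p j + δ * j) := by
    simp only [Filter.eventually_and, Filter.eventually_all]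
    exact ⟨fun i j h => hgen i j h 0, fun i j h => hgen i j h (-1), hlt⟩
  obtain ⟨δ, h0, h1, h2⟩ := hev.exists
  refine ⟨fun i => p i + δ * i, fun i j h => ?_, fun i j h => ?_, fun k l hl => ?_⟩
  · by_contra hij
    exact h0 i j hij (by simpa using h)
  · by_cases hij : i = j
    · subst hij
      linarith
    · exact h1 i j hij (h.trans (sub_eq_add_neg _ _))
  · rw [mem_typeEntry_iff] at hl ⊢
    intro j
    by_contra! hj
    exact absurd (hl j) (not_le.2 (h2 l j k hj))

/-- `x` attains its maximum exactly at `a`, no coordinate equals the maximum minus one, and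
the coordinates within distance one of the maximum are pairwise distinct. -/
structure GenericAt (x : Fin (d + 1) → ℝ) (a : Fin (d + 1)) : Prop where
  lt : ∀ j, j ≠ a → x j < x a
  ne : ∀ j, x j ≠ x a - 1
  inj : ∀ i j, x a - 1 < x i → x i = x j → i = j

theorem GenericAt.le {x : Fin (d + 1) → ℝ} {a : Fin (d + 1)} (h : GenericAt x a)
    (j : Fin (d + 1)) : x j ≤ x a := by
  by_cases hj : j = a
  · rw [hj]
  · exact (h.lt j hj).le

theorem GenericAt.mem_typeEntry_self {x : Fin (d + 1) → ℝ} {a : Fin (d + 1)}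
    (h : GenericAt x a) (Bs : Fin n → Finset (Fin (d + 1))) (l : Fin n) :
    l ∈ typeEntry (gen Bs) x a ↔ a ∈ Bs l ∨ ∀ j, x a - 1 < x j → j ∉ Bs l := by
  rw [mem_typeEntry_iff]
  by_cases ha : a ∈ Bs l
  · simp only [gen, ha, if_true, true_or, iff_true]
    intro j
    have := h.le j
    split_ifs <;> linarith
  · simp only [gen, ha, if_false, false_or]
    refine ⟨fun H j hj hjB => ?_, fun H j => ?_⟩
    · have := H j
      rw [if_pos hjB] at this
      linarith
    · have := h.le j
      split_ifs with hjB
      · have := not_lt.1 fun hj => H j hj hjB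
        linarith
      · linarith

theorem GenericAt.mem_typeEntry_of_ne {x : Fin (d + 1) → ℝ} {a : Fin (d + 1)}
    (h : GenericAt x a) (Bs : Fin n → Finset (Fin (d + 1))) (l : Fin n) {j : Fin (d + 1)}
    (hj : j ≠ a) :
    l ∈ typeEntry (gen Bs) x j ↔
      x a - 1 < x j ∧ j ∈ Bs l ∧ ∀ i, x j < x i → i ∉ Bs l := by
  rw [mem_typeEntry_iff]
  have hlt := h.lt j hj
  constructor
  · intro H
    have hjB : j ∈ Bs l := by
      by_contra hjB
      have := H a
      simp only [gen, hjB, if_false] at this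
      split_ifs at this <;> linarith
    simp only [gen, hjB, if_true] at H
    refine ⟨?_, hjB, fun i hi hiB => ?_⟩
    · have := H a
      have hne := h.ne j
      refine lt_of_le_of_ne ?_ hne.symm
      split_ifs at this <;> linarith
    · have := H i
      rw [if_pos hiB] at this
      linarith
  · rintro ⟨hS, hjB, H⟩ i
    have := h.le i
    simp only [gen, hjB, if_true]
    split_ifs with hiB
    · have := not_lt.1 fun hi => H i hi hiB
      linarith
    · linarith

theorem GenericAt.typeEntry_unique {x : Fin (d + 1) → ℝ} {a : Fin (d + 1)}
    (h : GenericAt x a) (Bs : Fin n → Finset (Fin (d + 1))) (l : Fin n) (i j : Fin (d + 1))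
    (hi : l ∈ typeEntry (gen Bs) x i) (hj : l ∈ typeEntry (gen Bs) x j) : i = j := by
  have key : ∀ j, j ≠ a → l ∈ typeEntry (gen Bs) x j → l ∉ typeEntry (gen Bs) x a := by
    intro j hja hj ha
    rw [h.mem_typeEntry_of_ne Bs l hja] at hj
    rw [h.mem_typeEntry_self] at ha
    rcases ha with ha | ha
    · exact hj.2.2 a (h.lt j hja) ha
    · exact ha j hj.1 hj.2.1
  by_cases hia : i = a
  · by_contra hij
    subst hia
    exact key j (Ne.symm hij) hj hi
  by_cases hja : j = a
  · subst hja
    exact absurd hj (key i hia hi)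
  rw [h.mem_typeEntry_of_ne Bs l hia] at hi
  rw [h.mem_typeEntry_of_ne Bs l hja] at hj
  refine h.inj i j hi.1 (le_antisymm ?_ ?_)
  · exact not_lt.1 fun hlt => hj.2.2 i hlt hi.2.1
  · exact not_lt.1 fun hlt => hi.2.2 j hlt hj.2.1

theorem GenericAt.ncard_typeEntry_self {x : Fin (d + 1) → ℝ} {a : Fin (d + 1)}
    (h : GenericAt x a) (Bs : Fin n → Finset (Fin (d + 1))) :
    (typeEntry (gen Bs) x a).ncard =
      bIJ Bs {a} ∅ + bIJ Bs ∅ (univ.filter fun j => x a - 1 < x j) := by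
  rw [bIJ, bIJ, ← card_union_of_disjoint, ← Set.ncard_coe_finset]
  · congr 1
    ext l
    simp [h.mem_typeEntry_self, Finset.disjoint_left]
  · rw [Finset.disjoint_left]
    intro l hl hl'
    simp only [mem_filter, mem_univ, true_and, singleton_subset_iff, Finset.disjoint_left]
      at hl hl'
    exact hl'.2 (by linarith) hl.1

theorem GenericAt.ncard_typeEntry_of_ne {x : Fin (d + 1) → ℝ} {a : Fin (d + 1)}
    (h : GenericAt x a) (Bs : Fin n → Finset (Fin (d + 1))) {j : Fin (d + 1)} (hj : j ≠ a)
    (hS : x a - 1 < x j) :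
    (typeEntry (gen Bs) x j).ncard = bIJ Bs {j} (univ.filter fun i => x j < x i) := by
  rw [bIJ, ← Set.ncard_coe_finset]
  congr 1
  ext l
  simp [h.mem_typeEntry_of_ne Bs l hj, hS, Finset.disjoint_left]

/-- A finite set can be listed in decreasing order of an injective function. -/
theorem exists_strictAnti_enumeration {α : Type*} [DecidableEq α] (T : Finset α) {r : ℕ}
    (hT : T.card = r) {y : α → ℝ} (hy : Function.Injective y) :
    ∃ σ : Fin r → α, StrictAnti (y ∘ σ) ∧ univ.image σ = T := by
  have hc : (T.image fun j => -y j).card = r := by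
    rwa [card_image_of_injective _ fun i j h => hy (neg_injective h)]
  have hmem : ∀ s, ∃ j ∈ T, -y j = (T.image fun j => -y j).orderEmbOfFin hc s := fun s =>
    mem_image.1 (orderEmbOfFin_mem _ hc s)
  choose σ hσT hσ using hmem
  have hanti : StrictAnti (y ∘ σ) := by
    intro s t hst
    have := ((T.image fun j => -y j).orderEmbOfFin hc).strictMono hst
    rw [← hσ, ← hσ] at this
    simpa using this
  refine ⟨σ, hanti, eq_of_subset_of_card_le ?_ ?_⟩
  · intro j hj
    obtain ⟨s, -, rfl⟩ := mem_image.1 hj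
    exact hσT s
  · rw [card_image_of_injective _ (hanti.injective.of_comp), card_univ, Fintype.card_fin, hT]

theorem MatroidData.nonempty {k : ℕ} {W : Type} [Finite W] {G : SimpleGraph W}
    {ε : Fin (d + 1) ≃ G.edgeSet} {Bs : Fin n → Finset (Fin (d + 1))}
    (hM : MatroidData d n k W G ε Bs) : Nonempty (Fin n) := by
  classical
  obtain ⟨T, hTG, hT⟩ := hM.connected.exists_isTree_le
  obtain ⟨l, -⟩ := hM.all (univ.filter fun i => (ε i : Sym2 W) ∈ T.edgeSet) (by
    have : edgeGraph G ε (univ.filter fun i => (ε i : Sym2 W) ∈ T.edgeSet) = T := by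
      rw [edgeGraph, ← SimpleGraph.fromEdgeSet_edgeSet T]
      congr 1
      ext s
      simp only [mem_filter, mem_univ, true_and, Set.mem_ofPred_eq,
        SimpleGraph.fromEdgeSet_edgeSet]
      constructor
      · rintro ⟨i, hi, rfl⟩
        exact hi
      · intro hs
        exact ⟨ε.symm ⟨s, SimpleGraph.edgeSet_mono hTG hs⟩, by simpa using hs, by simp⟩
    rw [IsSpanningTreeEdges, this]
    exact hT)
  exact ⟨l⟩

/-- The point with coordinates `0 > -1/r > ⋯ > -(r-1)/r` along `σ` and `-2` elsewhere. -/
def stairPoint {r : ℕ} (σ : Fin r → Fin (d + 1)) : Fin (d + 1) → ℝ :=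
  Function.extend σ (fun s => -((s : ℕ) : ℝ) / r) fun _ => -2

theorem stairPoint_lt_iff {r : ℕ} {σ : Fin r → Fin (d + 1)} (hσ : Function.Injective σ)
    (s t : Fin r) : stairPoint σ (σ s) < stairPoint σ (σ t) ↔ t < s := by
  have hr : (0 : ℝ) < r := by exact_mod_cast s.pos
  simp only [stairPoint, hσ.extend_apply]
  rw [div_lt_div_iff_of_pos_right hr, neg_lt_neg_iff, Nat.cast_lt, Fin.lt_def]

theorem stairPoint_of_notMem {r : ℕ} {σ : Fin r → Fin (d + 1)} {j : Fin (d + 1)}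
    (hj : ∀ s, σ s ≠ j) : stairPoint σ j = -2 :=
  Function.extend_apply' _ _ _ fun ⟨s, hs⟩ => hj s hs

theorem neg_one_lt_stairPoint_iff {r : ℕ} {σ : Fin r → Fin (d + 1)}
    (hσ : Function.Injective σ) (j : Fin (d + 1)) :
    -1 < stairPoint σ j ↔ ∃ s, σ s = j := by
  constructor
  · intro h
    by_contra! hj
    rw [stairPoint_of_notMem hj] at h
    norm_num at h
  · rintro ⟨s, rfl⟩
    have hr : (0 : ℝ) < r := by exact_mod_cast s.pos
    have hs : ((s : ℕ) : ℝ) < r := by exact_mod_cast s.isLt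
    rw [stairPoint, hσ.extend_apply, lt_div_iff₀ hr]
    linarith

theorem stairPoint_zero {r : ℕ} {σ : Fin (r + 1) → Fin (d + 1)}
    (hσ : Function.Injective σ) : stairPoint σ (σ 0) = 0 := by
  simp [stairPoint, hσ.extend_apply]

theorem genericAt_stairPoint {r : ℕ} {σ : Fin (r + 1) → Fin (d + 1)}
    (hσ : Function.Injective σ) : GenericAt (stairPoint σ) (σ 0) where
  lt j hj := by
    by_cases h : ∃ s, σ s = j
    · obtain ⟨s, rfl⟩ := h
      rw [stairPoint_lt_iff hσ, Fin.pos_iff_ne_zero]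
      exact fun hs => hj (by rw [hs])
    · rw [stairPoint_of_notMem (not_exists.1 h), stairPoint_zero hσ]
      norm_num
  ne j := by
    rw [stairPoint_zero hσ, zero_sub]
    by_cases h : ∃ s, σ s = j
    · exact ((neg_one_lt_stairPoint_iff hσ j).2 h).ne'
    · rw [stairPoint_of_notMem (not_exists.1 h)]
      norm_num
  inj i j hi hij := by
    rw [stairPoint_zero hσ, zero_sub] at hi
    obtain ⟨t, rfl⟩ := (neg_one_lt_stairPoint_iff hσ j).1 (hij ▸ hi)
    obtain ⟨s, rfl⟩ := (neg_one_lt_stairPoint_iff hσ i).1 hi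
    have h₁ := (stairPoint_lt_iff hσ s t).not.1 hij.not_lt
    have h₂ := (stairPoint_lt_iff hσ t s).not.1 hij.not_gt
    rw [le_antisymm (not_lt.1 h₁) (not_lt.1 h₂)]

theorem typeEntry_eq_of_isInteriorPoint {ι : Type*} {v : ι → Fin (d + 1) → ℝ}
    {p x : Fin (d + 1) → ℝ} (h : IsInteriorPoint v (closedCell v p) x) :
    typeEntry v x = typeEntry v p :=
  funext fun k => Set.Subset.antisymm (h.2 p (fun _ => subset_rfl) k) (h.1 k)

/-- Interior points of an inclusion-maximal cell have the type of some generic point. -/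
theorem exists_genericAt_of_isMaxCell {Bs : Fin n → Finset (Fin (d + 1))}
    {X : Set (Fin (d + 1) → ℝ)} {x : Fin (d + 1) → ℝ} (hX : IsMaxCell (gen Bs) X)
    (hx : IsInteriorPoint (gen Bs) X x) :
    ∃ (y : Fin (d + 1) → ℝ) (a : Fin (d + 1)), Function.Injective y ∧ GenericAt y a ∧
      typeEntry (gen Bs) x = typeEntry (gen Bs) y := by
  obtain ⟨⟨p, rfl⟩, hmax⟩ := hX
  obtain ⟨y, hinj, hne, hsub⟩ := exists_generic_typeEntry_subset (gen Bs) p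
  obtain ⟨a, ha⟩ := Finite.exists_max y
  refine ⟨y, a, hinj, ⟨fun j hj => (ha j).lt_of_ne (hinj.ne hj), fun j => hne j a,
    fun i j _ hij => hinj hij⟩, ?_⟩
  have hcell := hmax (closedCell (gen Bs) y) ⟨y, rfl⟩ fun z hz k => (hsub k).trans (hz k)
  have hy : y ∈ closedCell (gen Bs) p := hcell ▸ fun _ => subset_rfl
  rw [typeEntry_eq_of_isInteriorPoint hx]
  exact funext fun k => Set.Subset.antisymm (hy k) (hsub k)

/-- The coarse types of the inclusion-maximal cells of the tropical complex
of a tropical matroid polytope with `d+1` elements and rank `k` are exactly the tuples `t`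
for which there are `d' ≤ d+1-k` and distinct indices `i₁, …, i_{d'+1}` (given by an
injection `σ`) with `[d+1] ∖ {i₁,…,i_{d'}}` containing a basis, such that
`t_{i₁} = b_{{i₁},∅} + b_{∅,{i₁,…,i_{d'+1}}}`, `t_{i_l} = b_{{i_l},{i₁,…,i_{l-1}}}` for
`2 ≤ l ≤ d'+1`, and `t_j = 0` otherwise. -/
theorem coarseTypes_maxCells_tropicalMatroidPolytope
    (d n k : ℕ) (W : Type) [Fintype W] (G : SimpleGraph W)
    (ε : Fin (d + 1) ≃ G.edgeSet) (Bs : Fin n → Finset (Fin (d + 1)))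
    (hM : MatroidData d n k W G ε Bs) :
    ∀ t : Fin (d + 1) → ℕ,
      (∃ (X : Set (Fin (d + 1) → ℝ)) (x : Fin (d + 1) → ℝ),
        IsMaxCell (gen Bs) X ∧ IsInteriorPoint (gen Bs) X x ∧
        ∀ j, t j = (typeEntry (gen Bs) x j).ncard) ↔
      (∃ d' : ℕ, d' ≤ d + 1 - k ∧
        ∃ σ : Fin (d' + 1) → Fin (d + 1), Function.Injective σ ∧
          (∃ m : Fin n, ∀ s : Fin (d' + 1), (s : ℕ) < d' → σ s ∉ Bs m) ∧
          t (σ 0) = bIJ Bs {σ 0} ∅ + bIJ Bs ∅ (Finset.univ.image σ) ∧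
          (∀ l : Fin (d' + 1), 0 < l →
            t (σ l) = bIJ Bs {σ l} ((Finset.univ.filter (fun s => s < l)).image σ)) ∧
          (∀ j : Fin (d + 1), (∀ l, σ l ≠ j) → t j = 0)) := by
  classical
  intro t
  constructor
  · rintro ⟨X, x, hX, hx, ht⟩
    obtain ⟨y, a, hinj, hgen, hxy⟩ := exists_genericAt_of_isMaxCell hX hx
    rw [hxy] at ht
    obtain ⟨m₀⟩ := hM.nonempty
    set T : Finset (Fin (d + 1)) := univ.filter fun j =>
      y a - 1 < y j ∧ ∃ m, ∀ i, y j < y i → i ∉ Bs m with hT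
    have haT : a ∈ T := by
      simp only [hT, mem_filter, mem_univ, true_and]
      exact ⟨by linarith, m₀, fun i hi => absurd hi (hgen.le i).not_gt⟩
    obtain ⟨d', hd'⟩ := Nat.exists_eq_succ_of_ne_zero (card_pos.2 ⟨a, haT⟩).ne'
    obtain ⟨σ, hanti, hσT⟩ := exists_strictAnti_enumeration T hd' hinj
    have hσ : Function.Injective σ := hanti.injective.of_comp
    have hmemT : ∀ j, j ∈ T ↔ ∃ s, σ s = j := fun j => by simp [← hσT]
    have hlt : ∀ s t, y (σ s) < y (σ t) ↔ t < s := fun s t => hanti.lt_iff_gt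
    have hup : ∀ i j, j ∈ T → y j < y i → i ∈ T := by
      intro i j hj hij
      simp only [hT, mem_filter, mem_univ, true_and] at hj ⊢
      obtain ⟨m, hm⟩ := hj.2
      exact ⟨by linarith [hj.1], m, fun i' hi' => hm i' (hij.trans hi')⟩
    have hσ0 : σ 0 = a := by
      obtain ⟨s, hs⟩ := (hmemT a).1 haT
      by_contra hne
      have h := hgen.lt _ hne
      rw [← hs, hlt] at h
      exact absurd h (Fin.not_lt_zero s)
    obtain ⟨m, hm⟩ : ∃ m : Fin n, ∀ s : Fin (d' + 1), (s : ℕ) < d' → σ s ∉ Bs m := by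
      have h := (hmemT (σ (Fin.last d'))).2 ⟨_, rfl⟩
      simp only [hT, mem_filter, mem_univ, true_and] at h
      obtain ⟨m, hm⟩ := h.2
      exact ⟨m, fun s hs => hm _ ((hlt _ _).2 (by rwa [Fin.lt_def, Fin.val_last]))⟩
    refine ⟨d', ?_, σ, hσ, ⟨m, hm⟩, ?_, ?_, ?_⟩
    · have hdisj : Disjoint (Bs m) (univ.image fun s : Fin d' => σ s.castSucc) := by
        rw [Finset.disjoint_right]
        intro j hj
        obtain ⟨s, -, rfl⟩ := mem_image.1 hj
        exact hm _ (by simp)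
      have hc := card_le_univ (Bs m ∪ univ.image fun s : Fin d' => σ s.castSucc)
      rw [card_union_of_disjoint hdisj, hM.card,
        card_image_of_injective _ fun i j h => Fin.castSucc_injective d' (hσ h), card_univ,
        Fintype.card_fin, Fintype.card_fin] at hc
      omega
    · rw [ht, hσ0, hgen.ncard_typeEntry_self, hσT]
      congr 1
      rw [bIJ, bIJ]
      congr 1
      refine filter_congr fun l _ => and_congr_right fun _ => ?_
      refine ⟨fun h => h.mono_left fun j hj => ?_, fun h => ?_⟩
      · simp only [hT, mem_filter, mem_univ, true_and] at hj ⊢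
        exact hj.1
      · by_contra hcon
        obtain ⟨i, hiS, hiB⟩ := Finset.not_disjoint_iff.1 hcon
        obtain ⟨j, hj, hmaxj⟩ := exists_max_image (Bs l) y ⟨i, hiB⟩
        refine Finset.disjoint_left.1 h ?_ hj
        simp only [hT, mem_filter, mem_univ, true_and] at hiS ⊢
        exact ⟨hiS.trans_le (hmaxj i hiB), l, fun i' hi' hB => (hmaxj i' hB).not_gt hi'⟩
    · intro l hl
      have hlT := (hmemT (σ l)).2 ⟨l, rfl⟩
      have hla : σ l ≠ a := by
        rw [← hσ0]
        exact hσ.ne hl.ne'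
      have hS : y a - 1 < y (σ l) := by
        simp only [hT, mem_filter, mem_univ, true_and] at hlT
        exact hlT.1
      rw [ht, hgen.ncard_typeEntry_of_ne Bs hla hS]
      congr 1
      ext i
      simp only [mem_filter, mem_univ, true_and, mem_image]
      constructor
      · intro hi
        obtain ⟨s, rfl⟩ := (hmemT i).1 (hup i _ hlT hi)
        exact ⟨s, (hlt _ _).1 hi, rfl⟩
      · rintro ⟨s, hs, rfl⟩
        exact (hlt _ _).2 hs
    · intro j hj
      have hjT : j ∉ T := fun h => by
        obtain ⟨s, hs⟩ := (hmemT j).1 h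
        exact hj s hs
      have hja : j ≠ a := fun h => hjT (h ▸ haT)
      rw [ht, Set.ncard_eq_zero]
      refine Set.eq_empty_of_forall_notMem fun l hl => hjT ?_
      rw [hgen.mem_typeEntry_of_ne Bs l hja] at hl
      simp only [hT, mem_filter, mem_univ, true_and]
      exact ⟨hl.1, l, hl.2.2⟩
  · rintro ⟨d', -, σ, hσ, -, h0, h1, h2⟩
    have hgen := genericAt_stairPoint hσ
    refine ⟨closedCell (gen Bs) (stairPoint σ), stairPoint σ,
      isMaxCell_closedCell (hgen.typeEntry_unique Bs), ⟨fun _ => subset_rfl, fun y hy => hy⟩,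
      fun j => ?_⟩
    have hS : ∀ j, stairPoint σ (σ 0) - 1 < stairPoint σ j ↔ ∃ s, σ s = j := fun j => by
      rw [stairPoint_zero hσ, zero_sub, neg_one_lt_stairPoint_iff hσ]
    by_cases hj : ∃ s, σ s = j
    · obtain ⟨s, rfl⟩ := hj
      by_cases hs : s = 0
      · subst hs
        rw [h0, hgen.ncard_typeEntry_self]
        congr 2
        ext i
        simp [hS]
      · rw [h1 s (Fin.pos_iff_ne_zero.2 hs),
          hgen.ncard_typeEntry_of_ne Bs (hσ.ne hs) ((hS _).2 ⟨s, rfl⟩)]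
        congr 1
        ext i
        simp only [mem_filter, mem_univ, true_and, mem_image]
        constructor
        · rintro ⟨u, hu, rfl⟩
          exact (stairPoint_lt_iff hσ _ _).2 hu
        · intro hi
          obtain ⟨u, rfl⟩ := (hS i).1 (((hS _).2 ⟨s, rfl⟩).trans hi)
          exact ⟨u, (stairPoint_lt_iff hσ _ _).1 hi, rfl⟩
    · rw [h2 j (not_exists.1 hj), eq_comm, Set.ncard_eq_zero]
      refine Set.eq_empty_of_forall_notMem fun l hl => hj ?_
      rw [hgen.mem_typeEntry_of_ne Bs l fun h => hj ⟨0, h.symm⟩] at hl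
      exact (hS j).1 hl.1
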